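/- arXiv:2303.13429 — 3 statements merged into one kernel-verified Lean document; each statement's English description precedes it below -/
import Mathlib

section
/- Let U : ℝ^{d_θ} × ℝ^{d_x} → ℝ be differentiable with ‖∇U(θ,x) − ∇U(θ',x')‖ ≤ L_θ‖θ−θ'‖ + L_x‖x−x'‖ for all θ, θ', x, x' (where L_θ, L_x > 0), and satisfy ⟨v − v', ∇U(v) − ∇U(v')⟩ ≥ μ‖v − v'‖² for all v, v' with μ > 0. Then for every θ the function x ↦ ∇_θ U(θ,x) e^{−U(θ,x)} is integrable over ℝ^{d_x}, the marginal likelihood k(θ) := ∫_{ℝ^{d_x}} e^{−U(θ,x)} dx is differentiable in θ, and its gradient is given by differentiation under the integral sign: ∇k(θ) = −∫_{ℝ^{d_x}} ∇_θ U(θ, x) e^{−U(θ,x)} dx. -/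
open MeasureTheory InnerProductSpace
open scoped RealInnerProductSpace

noncomputable section

/-- The joint Euclidean space `ℝ^{d_θ} × ℝ^{d_x}`, equipped with the ℓ²-(Euclidean) norm. -/
abbrev PairSp (dθ dx : ℕ) := WithLp 2 (EuclideanSpace ℝ (Fin dθ) × EuclideanSpace ℝ (Fin dx))

/-- Form the pair `v = (θ, x)` in the joint Euclidean space. -/
def mkPair {dθ dx : ℕ} (θ : EuclideanSpace ℝ (Fin dθ)) (x : EuclideanSpace ℝ (Fin dx)) :
    PairSp dθ dx := (WithLp.equiv 2 _).symm (θ, x)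

/-- The partial gradient `∇_θ U(θ, x)` of `U` in the `θ`-variables. -/
def gradTheta {dθ dx : ℕ} (U : PairSp dθ dx → ℝ)
    (θ : EuclideanSpace ℝ (Fin dθ)) (x : EuclideanSpace ℝ (Fin dx)) :
    EuclideanSpace ℝ (Fin dθ) :=
  gradient (fun θ' => U (mkPair θ' x)) θ

/-- A strongly monotone gradient gives a quadratic lower bound. -/
theorem quadratic_lower_bound_of_strongly_monotone_gradient
    {E : Type*} [NormedAddCommGroup E] [InnerProductSpace ℝ E] [CompleteSpace E]
    {f : E → ℝ} {μ : ℝ} (hf : Differentiable ℝ f)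
    (hmono : ∀ v v' : E, μ * ‖v - v'‖ ^ 2 ≤ ⟪v - v', gradient f v - gradient f v'⟫_ℝ) (v : E) :
    f 0 + ⟪v, gradient f 0⟫_ℝ + μ / 2 * ‖v‖ ^ 2 ≤ f v := by
  let h : ℝ → ℝ := fun t => f (t • v) - t * ⟪v, gradient f 0⟫_ℝ - μ / 2 * ‖v‖ ^ 2 * t ^ 2
  have hd : ∀ t : ℝ, HasDerivAt h
      (⟪gradient f (t • v), v⟫_ℝ - ⟪v, gradient f 0⟫_ℝ - μ * ‖v‖ ^ 2 * t) t := by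
    intro t
    have hline : HasDerivAt (fun s : ℝ => s • v) v t := by
      simpa using (hasDerivAt_id t).smul_const v
    have hcomp : HasDerivAt (fun s : ℝ => f (s • v)) ⟪gradient f (t • v), v⟫_ℝ t := by
      have h := (hf (t • v)).hasGradientAt.hasFDerivAt.comp_hasDerivAt t hline
      rwa [toDual_apply_apply] at h
    have hlin := (hasDerivAt_id t).mul_const ⟪v, gradient f 0⟫_ℝ
    have hquad := (hasDerivAt_pow 2 t).const_mul (μ / 2 * ‖v‖ ^ 2)
    refine ((hcomp.sub hlin).sub hquad).congr_deriv ?_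
    simp
    ring
  have hmon : MonotoneOn h (Set.Ici 0) := by
    refine monotoneOn_of_deriv_nonneg (convex_Ici 0)
      (fun t _ => (hd t).continuousAt.continuousWithinAt)
      (fun t _ => (hd t).differentiableAt.differentiableWithinAt) fun t ht => ?_
    rw [interior_Ici] at ht
    have ht0 : 0 < t := ht
    rw [(hd t).deriv]
    have hm := hmono (t • v) 0
    rw [sub_zero, norm_smul, mul_pow, Real.norm_eq_abs, sq_abs, real_inner_smul_left,
      inner_sub_right, real_inner_comm] at hm
    have : t * (μ * ‖v‖ ^ 2 * t) ≤ t * (⟪gradient f (t • v), v⟫_ℝ - ⟪v, gradient f 0⟫_ℝ) := by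
      linarith
    linarith [le_of_mul_le_mul_left this ht0]
  have h01 := hmon (Set.mem_Ici.2 le_rfl) (Set.mem_Ici.2 zero_le_one) zero_le_one
  simp only [h, zero_smul, one_smul] at h01
  linarith

/-- A strongly monotone gradient gives a Gaussian upper bound on `exp (-f)`. -/
theorem exp_neg_le_gaussian_of_strongly_monotone_gradient
    {E : Type*} [NormedAddCommGroup E] [InnerProductSpace ℝ E] [CompleteSpace E]
    {f : E → ℝ} {μ : ℝ} (hμ : 0 < μ) (hf : Differentiable ℝ f)
    (hmono : ∀ v v' : E, μ * ‖v - v'‖ ^ 2 ≤ ⟪v - v', gradient f v - gradient f v'⟫_ℝ) (v : E) :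
    Real.exp (-f v) ≤
      Real.exp (‖gradient f 0‖ ^ 2 / μ - f 0) * Real.exp (-(μ / 4) * ‖v‖ ^ 2) := by
  rw [← Real.exp_add, Real.exp_le_exp]
  have hlow := quadratic_lower_bound_of_strongly_monotone_gradient hf hmono v
  have hcs := neg_le_of_abs_le (abs_real_inner_le_norm v (gradient f 0))
  have hamgm : ‖v‖ * ‖gradient f 0‖ ≤ ‖gradient f 0‖ ^ 2 / μ + μ / 4 * ‖v‖ ^ 2 := by
    have : ‖gradient f 0‖ ^ 2 / μ + μ / 4 * ‖v‖ ^ 2 - ‖v‖ * ‖gradient f 0‖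
        = (‖gradient f 0‖ - μ / 2 * ‖v‖) ^ 2 / μ := by
      field_simp
      ring
    have : 0 ≤ (‖gradient f 0‖ - μ / 2 * ‖v‖) ^ 2 / μ := by positivity
    linarith
  linarith

theorem integrable_exp_neg_mul_sq_norm
    {V : Type*} [NormedAddCommGroup V] [InnerProductSpace ℝ V] [FiniteDimensional ℝ V]
    [MeasurableSpace V] [BorelSpace V] {b : ℝ} (hb : 0 < b) :
    Integrable (fun v : V => Real.exp (-b * ‖v‖ ^ 2)) := by
  have h := (GaussianFourier.integrable_cexp_neg_mul_sq_norm_add (V := V) (b := (b : ℂ))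
    (by simpa using hb) 0 0).norm
  refine h.congr (.of_forall fun v => ?_)
  simp [Complex.norm_exp, ← Complex.ofReal_pow]

theorem integrable_affine_mul_exp_neg_mul_sq_norm
    {V : Type*} [NormedAddCommGroup V] [InnerProductSpace ℝ V] [FiniteDimensional ℝ V]
    [MeasurableSpace V] [BorelSpace V] {b : ℝ} (hb : 0 < b) (A B : ℝ) :
    Integrable (fun v : V => (A + B * ‖v‖) * Real.exp (-b * ‖v‖ ^ 2)) := by
  refine ((integrable_exp_neg_mul_sq_norm (V := V) (half_pos hb)).const_mul
    (|A| + |B| * (1 + 2 / b))).mono' (by fun_prop) (.of_forall fun v => ?_)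
  have hsplit : Real.exp (-b * ‖v‖ ^ 2) =
      Real.exp (-(b / 2) * ‖v‖ ^ 2) * Real.exp (-(b / 2 * ‖v‖ ^ 2)) := by
    rw [← Real.exp_add]
    ring_nf
  have hlin : ‖v‖ * Real.exp (-(b / 2 * ‖v‖ ^ 2)) ≤ 1 + 2 / b := by
    rw [Real.exp_neg, ← div_eq_mul_inv, div_le_iff₀ (Real.exp_pos _)]
    have h1 := Real.add_one_le_exp (b / 2 * ‖v‖ ^ 2)
    have h2 : (1 + 2 / b) * (b / 2 * ‖v‖ ^ 2 + 1) =
        b / 2 * ‖v‖ ^ 2 + 1 + ‖v‖ ^ 2 + 2 / b := by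
      field_simp
      ring
    have h3 : (0 : ℝ) ≤ b / 2 * ‖v‖ ^ 2 := by positivity
    have h4 : (0 : ℝ) < 2 / b := by positivity
    have h5 := mul_le_mul_of_nonneg_left h1 (by positivity : (0 : ℝ) ≤ 1 + 2 / b)
    nlinarith [sq_nonneg (‖v‖ - 1)]
  have hone : Real.exp (-(b / 2 * ‖v‖ ^ 2)) ≤ 1 :=
    Real.exp_le_one_iff.2 (neg_nonpos.2 (by positivity))
  have habs : |A + B * ‖v‖| ≤ |A| + |B| * ‖v‖ := by
    simpa [abs_mul] using abs_add_le A (B * ‖v‖)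
  rw [norm_mul, Real.norm_eq_abs, Real.norm_eq_abs, Real.abs_exp, hsplit]
  calc |A + B * ‖v‖| * (Real.exp (-(b / 2) * ‖v‖ ^ 2) * Real.exp (-(b / 2 * ‖v‖ ^ 2)))
      ≤ (|A| + |B| * ‖v‖) *
          (Real.exp (-(b / 2) * ‖v‖ ^ 2) * Real.exp (-(b / 2 * ‖v‖ ^ 2))) := by gcongr
    _ = (|A| * Real.exp (-(b / 2 * ‖v‖ ^ 2)) + |B| * (‖v‖ * Real.exp (-(b / 2 * ‖v‖ ^ 2)))) *
          Real.exp (-(b / 2) * ‖v‖ ^ 2) := by ring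
    _ ≤ (|A| * 1 + |B| * (1 + 2 / b)) * Real.exp (-(b / 2) * ‖v‖ ^ 2) := by gcongr
    _ = (|A| + |B| * (1 + 2 / b)) * Real.exp (-(b / 2) * ‖v‖ ^ 2) := by rw [mul_one]

/-- Differentiation under the integral sign, in terms of gradients. -/
theorem hasGradientAt_integral_of_dominated
    {H : Type*} [NormedAddCommGroup H] [InnerProductSpace ℝ H] [CompleteSpace H]
    {α : Type*} [MeasurableSpace α] {ν : Measure α} {F : H → α → ℝ} {F' : H → α → H}
    {bound : α → ℝ} {s : Set H} {θ : H} (hs : s ∈ nhds θ)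
    (hF_meas : ∀ θ', AEStronglyMeasurable (F θ') ν) (hF_int : Integrable (F θ) ν)
    (hF'_meas : AEStronglyMeasurable (F' θ) ν)
    (h_bound : ∀ a, ∀ θ' ∈ s, ‖F' θ' a‖ ≤ bound a) (bound_integrable : Integrable bound ν)
    (h_diff : ∀ a, ∀ θ' ∈ s, HasGradientAt (F · a) (F' θ' a) θ') :
    HasGradientAt (fun θ' => ∫ a, F θ' a ∂ν) (∫ a, F' θ a ∂ν) θ := by
  have hmeas : AEStronglyMeasurable (fun a => toDual ℝ H (F' θ a)) ν :=
    (toDual ℝ H).continuous.comp_aestronglyMeasurable hF'_meas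
  have hint : Integrable (F' θ) ν :=
    bound_integrable.mono' hF'_meas (.of_forall fun a => h_bound a θ (mem_of_mem_nhds hs))
  have hint' : Integrable (fun a => toDual ℝ H (F' θ a)) ν :=
    bound_integrable.mono' hmeas (.of_forall fun a => by
      simpa using h_bound a θ (mem_of_mem_nhds hs))
  have hder := hasFDerivAt_integral_of_dominated_of_fderiv_le
    (F' := fun θ' a => toDual ℝ H (F' θ' a)) hs
    (.of_forall hF_meas) hF_int hmeas
    (.of_forall fun a θ' hθ' => by simpa using h_bound a θ' hθ') bound_integrable
    (.of_forall fun a θ' hθ' => (h_diff a θ' hθ').hasFDerivAt)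
  rw [hasGradientAt_iff_hasFDerivAt]
  convert! hder using 1
  ext y
  rw [ContinuousLinearMap.integral_apply hint' y]
  simp only [toDual_apply_apply]
  rw [real_inner_comm, ← integral_inner hint y]
  simp only [real_inner_comm]

section MkPair

variable {dθ dx : ℕ}

theorem norm_snd_le_norm_mkPair (θ : EuclideanSpace ℝ (Fin dθ)) (x : EuclideanSpace ℝ (Fin dx)) :
    ‖x‖ ≤ ‖mkPair θ x‖ := by
  have h := WithLp.prod_norm_sq_eq_of_L2 (mkPair θ x)
  refine le_of_sq_le_sq ?_ (norm_nonneg _)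
  rw [h]
  exact le_add_of_nonneg_left (sq_nonneg _)

theorem norm_fst_le_norm (v : PairSp dθ dx) : ‖v.fst‖ ≤ ‖v‖ := by
  refine le_of_sq_le_sq ?_ (norm_nonneg _)
  rw [WithLp.prod_norm_sq_eq_of_L2 v]
  exact le_add_of_nonneg_right (sq_nonneg _)

theorem continuous_mkPair (θ : EuclideanSpace ℝ (Fin dθ)) :
    Continuous (fun x : EuclideanSpace ℝ (Fin dx) => mkPair θ x) :=
  (WithLp.prodContinuousLinearEquiv 2 ℝ _ _).symm.continuous.comp (Continuous.prodMk_right θ)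

theorem hasGradientAt_comp_mkPair {U : PairSp dθ dx → ℝ} (hU : Differentiable ℝ U)
    (θ : EuclideanSpace ℝ (Fin dθ)) (x : EuclideanSpace ℝ (Fin dx)) :
    HasGradientAt (fun θ' => U (mkPair θ' x)) (gradient U (mkPair θ x)).fst θ := by
  let e := (WithLp.prodContinuousLinearEquiv 2 ℝ (EuclideanSpace ℝ (Fin dθ))
    (EuclideanSpace ℝ (Fin dx))).symm
  have hpair : HasFDerivAt (fun θ' : EuclideanSpace ℝ (Fin dθ) => mkPair θ' x)
      (e.toContinuousLinearMap ∘L ContinuousLinearMap.inl ℝ _ _) θ :=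
    e.hasFDerivAt.comp θ (hasFDerivAt_prodMk_left θ x)
  rw [hasGradientAt_iff_hasFDerivAt]
  convert! (hU (mkPair θ x)).hasGradientAt.hasFDerivAt.comp θ hpair using 1
  ext y
  have h : ⟪gradient U (mkPair θ x), WithLp.toLp 2 (y, 0)⟫_ℝ =
      ⟪(gradient U (mkPair θ x)).fst, y⟫_ℝ := by
    rw [WithLp.prod_inner_apply]
    simp
  simpa [e] using h.symm

theorem gradTheta_eq_fst {U : PairSp dθ dx → ℝ} (hU : Differentiable ℝ U)
    (θ : EuclideanSpace ℝ (Fin dθ)) (x : EuclideanSpace ℝ (Fin dx)) :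
    gradTheta U θ x = (gradient U (mkPair θ x)).fst :=
  (hasGradientAt_comp_mkPair hU θ x).gradient

theorem hasGradientAt_exp_neg_comp_mkPair {U : PairSp dθ dx → ℝ} (hU : Differentiable ℝ U)
    (θ : EuclideanSpace ℝ (Fin dθ)) (x : EuclideanSpace ℝ (Fin dx)) :
    HasGradientAt (fun θ' => Real.exp (-U (mkPair θ' x)))
      (-(Real.exp (-U (mkPair θ x)) • gradTheta U θ x)) θ := by
  have h := (hasGradientAt_comp_mkPair hU θ x).hasFDerivAt.neg.exp
  rw [hasGradientAt_iff_hasFDerivAt, gradTheta_eq_fst hU]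
  convert! h using 1
  ext y
  simp

end MkPair

/-- under Lipschitz-gradient and strong-monotonicity assumptions on `U`, for
every `θ` the function `x ↦ ∇_θ U(θ,x) e^{-U(θ,x)}` is integrable, the marginal likelihood
`k(θ) = ∫ e^{-U(θ,x)} dx` is differentiable, and
`∇k(θ) = -∫ ∇_θ U(θ,x) e^{-U(θ,x)} dx` (differentiation under the integral sign). -/
theorem gradient_marginal_likelihood
    {dθ dx : ℕ} (hdθ : 1 ≤ dθ) (hdx : 1 ≤ dx) (Lθ Lx μ : ℝ)
    (hLθ : 0 < Lθ) (hLx : 0 < Lx) (hμ : 0 < μ)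
    (U : PairSp dθ dx → ℝ) (hdiff : Differentiable ℝ U)
    (hlip : ∀ (θ θ' : EuclideanSpace ℝ (Fin dθ)) (x x' : EuclideanSpace ℝ (Fin dx)),
      ‖gradient U (mkPair θ x) - gradient U (mkPair θ' x')‖ ≤ Lθ * ‖θ - θ'‖ + Lx * ‖x - x'‖)
    (hmono : ∀ v v' : PairSp dθ dx,
      μ * ‖v - v'‖ ^ 2 ≤ ⟪v - v', gradient U v - gradient U v'⟫_ℝ) :
    (∀ θ : EuclideanSpace ℝ (Fin dθ),
      Integrable (fun x : EuclideanSpace ℝ (Fin dx) =>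
        Real.exp (-U (mkPair θ x)) • gradTheta U θ x)) ∧
    Differentiable ℝ (fun θ : EuclideanSpace ℝ (Fin dθ) =>
        ∫ x : EuclideanSpace ℝ (Fin dx), Real.exp (-U (mkPair θ x))) ∧
    ∀ θ : EuclideanSpace ℝ (Fin dθ),
      gradient (fun θ' : EuclideanSpace ℝ (Fin dθ) =>
          ∫ x : EuclideanSpace ℝ (Fin dx), Real.exp (-U (mkPair θ' x))) θ
        = -∫ x : EuclideanSpace ℝ (Fin dx), Real.exp (-U (mkPair θ x)) • gradTheta U θ x := by
  have hcontU : Continuous U :=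
    continuous_iff_continuousAt.2 fun v => (hdiff v).hasGradientAt.continuousAt
  have hexp : ∀ (θ : EuclideanSpace ℝ (Fin dθ)) (x : EuclideanSpace ℝ (Fin dx)),
      Real.exp (-U (mkPair θ x)) ≤
        Real.exp (‖gradient U 0‖ ^ 2 / μ - U 0) * Real.exp (-(μ / 4) * ‖x‖ ^ 2) := by
    intro θ x
    refine (exp_neg_le_gaussian_of_strongly_monotone_gradient hμ hdiff hmono _).trans ?_
    have hx := norm_snd_le_norm_mkPair θ x
    simp only [neg_mul]
    gcongr
  have hcontF : ∀ θ : EuclideanSpace ℝ (Fin dθ),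
      Continuous (fun x : EuclideanSpace ℝ (Fin dx) => Real.exp (-U (mkPair θ x))) := fun θ =>
    Real.continuous_exp.comp (hcontU.comp (continuous_mkPair θ)).neg
  have hintF : ∀ θ : EuclideanSpace ℝ (Fin dθ),
      Integrable (fun x : EuclideanSpace ℝ (Fin dx) => Real.exp (-U (mkPair θ x))) := by
    intro θ
    have hgauss : Integrable (fun x : EuclideanSpace ℝ (Fin dx) =>
        Real.exp (‖gradient U 0‖ ^ 2 / μ - U 0) * Real.exp (-(μ / 4) * ‖x‖ ^ 2)) :=
      (integrable_exp_neg_mul_sq_norm (by positivity)).const_mul _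
    refine hgauss.mono' (hcontF θ).aestronglyMeasurable (.of_forall fun x => ?_)
    rw [Real.norm_eq_abs, Real.abs_exp]
    exact hexp θ x
  have hcontG : ∀ θ : EuclideanSpace ℝ (Fin dθ),
      Continuous (fun x : EuclideanSpace ℝ (Fin dx) => gradTheta U θ x) := by
    intro θ
    refine (LipschitzWith.of_dist_le_mul (K := ⟨Lx, hLx.le⟩) fun x x' => ?_).continuous
    rw [dist_eq_norm, dist_eq_norm, gradTheta_eq_fst hdiff, gradTheta_eq_fst hdiff,
      ← WithLp.sub_fst]
    refine (norm_fst_le_norm _).trans ((hlip θ θ x x').trans ?_)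
    rw [sub_self, norm_zero, mul_zero, zero_add]
    exact le_rfl
  have hG : ∀ (θ : EuclideanSpace ℝ (Fin dθ)) (x : EuclideanSpace ℝ (Fin dx)),
      ‖gradTheta U θ x‖ ≤ ‖gradient U 0‖ + Lθ * ‖θ‖ + Lx * ‖x‖ := by
    intro θ x
    rw [gradTheta_eq_fst hdiff]
    refine (norm_fst_le_norm _).trans ?_
    have h := hlip θ 0 x 0
    rw [sub_zero, sub_zero] at h
    have h0 : (mkPair 0 0 : PairSp dθ dx) = 0 := rfl
    rw [h0] at h
    linarith [norm_le_norm_add_norm_sub' (gradient U (mkPair θ x)) (gradient U 0)]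
  have hbound : ∀ θ : EuclideanSpace ℝ (Fin dθ), ∀ x : EuclideanSpace ℝ (Fin dx),
      ∀ θ' ∈ Metric.ball θ 1, ‖-(Real.exp (-U (mkPair θ' x)) • gradTheta U θ' x)‖ ≤
        Real.exp (‖gradient U 0‖ ^ 2 / μ - U 0) *
          ((‖gradient U 0‖ + Lθ * (‖θ‖ + 1) + Lx * ‖x‖) * Real.exp (-(μ / 4) * ‖x‖ ^ 2)) := by
    intro θ x θ' hθ'
    have hθ'' : ‖θ'‖ ≤ ‖θ‖ + 1 := by
      rw [Metric.mem_ball, dist_eq_norm] at hθ'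
      linarith [norm_le_norm_add_norm_sub' θ' θ]
    rw [norm_neg, norm_smul, Real.norm_eq_abs, Real.abs_exp]
    calc Real.exp (-U (mkPair θ' x)) * ‖gradTheta U θ' x‖
        ≤ (Real.exp (‖gradient U 0‖ ^ 2 / μ - U 0) * Real.exp (-(μ / 4) * ‖x‖ ^ 2)) *
            (‖gradient U 0‖ + Lθ * ‖θ'‖ + Lx * ‖x‖) := by
          gcongr
          exacts [hexp θ' x, hG θ' x]
      _ ≤ (Real.exp (‖gradient U 0‖ ^ 2 / μ - U 0) * Real.exp (-(μ / 4) * ‖x‖ ^ 2)) *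
            (‖gradient U 0‖ + Lθ * (‖θ‖ + 1) + Lx * ‖x‖) := by gcongr
      _ = _ := by ring
  have hbint : ∀ θ : EuclideanSpace ℝ (Fin dθ),
      Integrable (fun x : EuclideanSpace ℝ (Fin dx) =>
        Real.exp (‖gradient U 0‖ ^ 2 / μ - U 0) *
          ((‖gradient U 0‖ + Lθ * (‖θ‖ + 1) + Lx * ‖x‖) * Real.exp (-(μ / 4) * ‖x‖ ^ 2))) :=
    fun θ => (integrable_affine_mul_exp_neg_mul_sq_norm (by positivity) _ _).const_mul _
  have hgrad : ∀ θ : EuclideanSpace ℝ (Fin dθ),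
      HasGradientAt (fun θ' : EuclideanSpace ℝ (Fin dθ) =>
          ∫ x : EuclideanSpace ℝ (Fin dx), Real.exp (-U (mkPair θ' x)))
        (-∫ x : EuclideanSpace ℝ (Fin dx), Real.exp (-U (mkPair θ x)) • gradTheta U θ x) θ := by
    intro θ
    rw [← integral_neg]
    exact hasGradientAt_integral_of_dominated
      (F' := fun θ' x => -(Real.exp (-U (mkPair θ' x)) • gradTheta U θ' x))
      (Metric.ball_mem_nhds θ one_pos)
      (fun θ' => (hcontF θ').aestronglyMeasurable) (hintF θ)
      ((hcontF θ).smul (hcontG θ)).neg.aestronglyMeasurable (hbound θ) (hbint θ)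
      (fun x θ' _ => hasGradientAt_exp_neg_comp_mkPair hdiff θ' x)
  refine ⟨fun θ => ?_, fun θ => (hgrad θ).differentiableAt, fun θ => (hgrad θ).gradient⟩
  refine (hbint θ).mono' ((hcontF θ).smul (hcontG θ)).aestronglyMeasurable
    (.of_forall fun x => ?_)
  rw [← norm_neg]
  exact hbound θ x θ (Metric.mem_ball_self one_pos)
end
end

section
/- Let U : ℝ^{d_θ} × ℝ^{d_x} → ℝ be continuous and satisfy the strong convexity condition that v ↦ U(v) − (μ/2)‖v‖² is convex on ℝ^{d_θ} × ℝ^{d_x} for some μ > 0 (equivalently, when U is differentiable, ⟨v − v', ∇U(v) − ∇U(v')⟩ ≥ μ‖v − v'‖²). Define k(θ) := ∫_{ℝ^{d_x}} e^{−U(θ,x)} dx and κ(θ) := −log k(θ). Then k(θ) ∈ (0, ∞) for every θ, and κ is μ-strongly convex: the function θ ↦ κ(θ) − (μ/2)‖θ‖² is convex on ℝ^{d_θ}. (This is the Prékopa–Leindler consequence that the θ-marginal of a μ-strongly log-concave density is μ-strongly log-concave.) -/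
open MeasureTheory
open scoped RealInnerProductSpace

noncomputable section

open scoped ENNReal

theorem Real.volume_add_volume_le_of_isCompact {K L C : Set ℝ} (hK : IsCompact K)
    (hL : IsCompact L) (hK₀ : K.Nonempty) (hL₀ : L.Nonempty)
    (h : ∀ x ∈ K, ∀ y ∈ L, x + y ∈ C) : volume K + volume L ≤ volume C := by
  obtain ⟨p, hp⟩ := hK.exists_isGreatest hK₀
  obtain ⟨q, hq⟩ := hL.exists_isLeast hL₀
  have hL' : MeasurableSet ((fun y ↦ p + y) '' L) :=
    (hL.image (continuous_const_add p)).measurableSet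
  have hdisj : AEDisjoint volume ((fun x ↦ x + q) '' K) ((fun y ↦ p + y) '' L) := by
    refine measure_mono_null (t := {p + q}) ?_ (by simp)
    rintro _ ⟨⟨x, hx, rfl⟩, y, hy, hxy⟩
    have h₁ := hp.2 hx
    have h₂ := hq.2 hy
    simp only at hxy
    simp only [Set.mem_singleton_iff]
    linarith
  calc volume K + volume L
      = volume ((fun x ↦ x + q) '' K) + volume ((fun y ↦ p + y) '' L) := by simp
    _ = volume ((fun x ↦ x + q) '' K ∪ (fun y ↦ p + y) '' L) :=
      (measure_union₀ hL'.nullMeasurableSet hdisj).symm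
    _ ≤ volume C := by
      refine measure_mono (Set.union_subset ?_ ?_)
      · rintro _ ⟨x, hx, rfl⟩
        exact h x hx q hq.1
      · rintro _ ⟨y, hy, rfl⟩
        exact h p hp.1 y hy

/-- The one-dimensional Brunn–Minkowski inequality. -/
theorem Real.volume_add_volume_le {A B C : Set ℝ} (hA : MeasurableSet A) (hB : MeasurableSet B)
    (hA₀ : A.Nonempty) (hB₀ : B.Nonempty) (h : ∀ x ∈ A, ∀ y ∈ B, x + y ∈ C) :
    volume A + volume B ≤ volume C := by
  obtain ⟨a, ha⟩ := hA₀
  obtain ⟨b, hb⟩ := hB₀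
  rw [hA.measure_eq_iSup_isCompact, hB.measure_eq_iSup_isCompact]
  simp only [iSup_and']
  refine ENNReal.biSup_add_biSup_le' ⟨∅, by simp⟩ ⟨∅, by simp⟩ ?_
  rintro K ⟨hKA, hK⟩ L ⟨hLB, hL⟩
  rcases K.eq_empty_or_nonempty with rfl | hK₀
  · calc volume ∅ + volume L = volume ((fun y ↦ a + y) '' L) := by simp
      _ ≤ volume C := measure_mono (by rintro _ ⟨y, hy, rfl⟩; exact h a ha y (hLB hy))
  rcases L.eq_empty_or_nonempty with rfl | hL₀
  · calc volume K + volume ∅ = volume ((fun x ↦ x + b) '' K) := by simp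
      _ ≤ volume C := measure_mono (by rintro _ ⟨x, hx, rfl⟩; exact h x (hKA hx) b hb)
  exact Real.volume_add_volume_le_of_isCompact hK hL hK₀ hL₀
    fun x hx y hy ↦ h x (hKA hx) y (hLB hy)

theorem ENNReal.geom_mean_le_arith_mean2_weighted {a b : ℝ} (ha : 0 < a) (hb : 0 < b)
    (hab : a + b = 1) (x y : ℝ≥0∞) :
    x ^ a * y ^ b ≤ ENNReal.ofReal a * x + ENNReal.ofReal b * y := by
  have ha' := ENNReal.ofReal_pos.2 ha
  have hb' := ENNReal.ofReal_pos.2 hb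
  induction x with
  | top => simp [ENNReal.mul_top, ha'.ne']
  | coe x =>
    induction y with
    | top => simp [ENNReal.mul_top, hb'.ne']
    | coe y =>
      rw [← ENNReal.coe_rpow_of_nonneg _ ha.le, ← ENNReal.coe_rpow_of_nonneg _ hb.le]
      have := NNReal.geom_mean_le_arith_mean2_weighted a.toNNReal b.toNNReal x y
        (by rw [← Real.toNNReal_add ha.le hb.le, hab, Real.toNNReal_one])
      rw [Real.coe_toNNReal a ha.le, Real.coe_toNNReal b hb.le] at this
      simp only [ENNReal.ofReal]
      exact_mod_cast this

theorem ENNReal.min_le_geom_mean2_weighted {a b : ℝ} (ha : 0 < a) (hb : 0 < b)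
    (hab : a + b = 1) (x y : ℝ≥0∞) : min x y ≤ x ^ a * y ^ b := by
  calc min x y = min x y ^ a * min x y ^ b := by
        rw [← ENNReal.rpow_add_of_nonneg _ _ ha.le hb.le, hab, ENNReal.rpow_one]
    _ ≤ x ^ a * y ^ b := by
      gcongr
      · exact min_le_left _ _
      · exact min_le_right _ _

theorem MeasureTheory.lintegral_eq_lintegral_meas_ofReal_lt {α : Type*} [MeasurableSpace α]
    (μ : Measure α) {f : α → ℝ≥0∞} (hf : Measurable f) (hf' : ∀ x, f x ≠ ∞) :
    ∫⁻ x, f x ∂μ = ∫⁻ t in Set.Ioi (0 : ℝ), μ {x | ENNReal.ofReal t < f x} := by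
  have := lintegral_eq_lintegral_meas_lt μ (f := fun x ↦ (f x).toReal)
    (Filter.Eventually.of_forall fun _ ↦ ENNReal.toReal_nonneg) hf.ennreal_toReal.aemeasurable
  simp only [ENNReal.ofReal_toReal (hf' _)] at this
  rw [this]
  refine setLIntegral_congr_fun measurableSet_Ioi fun t ht ↦ ?_
  simp only [ENNReal.ofReal_lt_iff_lt_toReal (le_of_lt ht) (hf' _)]

theorem Real.lintegral_add_lintegral_le_of_min_le {a b : ℝ} (ha : 0 < a) (hb : 0 < b)
    {f g h : ℝ → ℝ≥0∞} (hf : Measurable f) (hg : Measurable g) (hh : Measurable h)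
    (hf₁ : ⨆ x, f x = 1) (hg₁ : ⨆ x, g x = 1)
    (hfgh : ∀ x y, min (f x) (g y) ≤ h (a * x + b * y)) :
    ENNReal.ofReal a * (∫⁻ x, f x) + ENNReal.ofReal b * (∫⁻ x, g x) ≤ ∫⁻ x, h x := by
  have hf_le x : f x ≤ 1 := hf₁ ▸ le_iSup f x
  have hg_le x : g x ≤ 1 := hg₁ ▸ le_iSup g x
  refine le_trans ?_ (lintegral_mono fun x ↦ min_le_left (h x) 1)
  rw [lintegral_eq_lintegral_meas_ofReal_lt _ hf
      fun x ↦ ((hf_le x).trans_lt ENNReal.one_lt_top).ne,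
    lintegral_eq_lintegral_meas_ofReal_lt _ hg
      fun x ↦ ((hg_le x).trans_lt ENNReal.one_lt_top).ne,
    lintegral_eq_lintegral_meas_ofReal_lt _ (hh.min measurable_const)
      fun x ↦ ((min_le_right _ _).trans_lt ENNReal.one_lt_top).ne,
    ← lintegral_const_mul' _ _ ENNReal.ofReal_ne_top,
    ← lintegral_const_mul' _ _ ENNReal.ofReal_ne_top]
  refine (le_lintegral_add _ _).trans (lintegral_mono fun s ↦ ?_)
  simp only
  rcases le_or_gt 1 (ENNReal.ofReal s) with hs | hs
  · have h₁ : {x | ENNReal.ofReal s < f x} = ∅ := by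
      ext x; simpa using (hf_le x).trans hs
    have h₂ : {x | ENNReal.ofReal s < g x} = ∅ := by
      ext x; simpa using (hg_le x).trans hs
    simp [h₁, h₂]
  obtain ⟨x₀, hx₀⟩ := lt_iSup_iff.1 (hf₁ ▸ hs)
  obtain ⟨y₀, hy₀⟩ := lt_iSup_iff.1 (hg₁ ▸ hs)
  have hA : MeasurableSet {x | ENNReal.ofReal s < f x} := measurableSet_lt measurable_const hf
  have hB : MeasurableSet {x | ENNReal.ofReal s < g x} := measurableSet_lt measurable_const hg
  have key := Real.volume_add_volume_le (C := {x | ENNReal.ofReal s < min (h x) 1})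
    (hA.const_smul₀ a) (hB.const_smul₀ b) (Set.Nonempty.smul_set ⟨x₀, hx₀⟩)
    (Set.Nonempty.smul_set ⟨y₀, hy₀⟩) (by
      rintro _ ⟨x, hx, rfl⟩ _ ⟨y, hy, rfl⟩
      exact lt_min ((lt_min hx hy).trans_le (hfgh x y)) hs)
  simpa [Measure.addHaar_smul, abs_of_pos ha, abs_of_pos hb] using key

/-- The Prékopa–Leindler inequality holds on the measure space `E`. -/
def PrekopaLeindler (E : Type*) [AddCommGroup E] [Module ℝ E] [MeasureSpace E] : Prop :=
  ∀ ⦃a b : ℝ⦄, 0 < a → 0 < b → a + b = 1 → ∀ ⦃f g h : E → ℝ≥0∞⦄,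
    Measurable f → Measurable g → Measurable h →
    (∀ x y, f x ^ a * g y ^ b ≤ h (a • x + b • y)) →
    (∫⁻ x, f x) ^ a * (∫⁻ x, g x) ^ b ≤ ∫⁻ x, h x

theorem Real.prekopaLeindler_of_bounded {a b : ℝ} (ha : 0 < a) (hb : 0 < b) (hab : a + b = 1)
    {f g h : ℝ → ℝ≥0∞} (hf : Measurable f) (hg : Measurable g) (hh : Measurable h)
    (hf_top : ⨆ x, f x ≠ ∞) (hg_top : ⨆ x, g x ≠ ∞)
    (hfgh : ∀ x y, f x ^ a * g y ^ b ≤ h (a * x + b * y)) :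
    (∫⁻ x, f x) ^ a * (∫⁻ x, g x) ^ b ≤ ∫⁻ x, h x := by
  set M := ⨆ x, f x with hM
  set N := ⨆ x, g x with hN
  rcases eq_or_ne M 0 with hM₀ | hM₀
  · have : f = fun _ ↦ 0 := funext fun x ↦ le_zero_iff.1 (hM₀ ▸ le_iSup f x)
    simp [this, ENNReal.zero_rpow_of_pos ha]
  rcases eq_or_ne N 0 with hN₀ | hN₀
  · have : g = fun _ ↦ 0 := funext fun x ↦ le_zero_iff.1 (hN₀ ▸ le_iSup g x)
    simp [this, ENNReal.zero_rpow_of_pos hb]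
  have hMa : M ^ a ≠ 0 := by simp [hM₀, ha.le]
  have hNb : N ^ b ≠ 0 := by simp [hN₀, hb.le]
  have hMa' : M ^ a ≠ ∞ := ENNReal.rpow_ne_top_of_nonneg ha.le hf_top
  have hNb' : N ^ b ≠ ∞ := ENNReal.rpow_ne_top_of_nonneg hb.le hg_top
  have hinv : (M⁻¹) ^ a * (N⁻¹) ^ b = (M ^ a * N ^ b)⁻¹ := by
    rw [ENNReal.mul_inv (.inl hMa) (.inl hMa'), ENNReal.inv_rpow, ENNReal.inv_rpow]
  have key := Real.lintegral_add_lintegral_le_of_min_le ha hb (hf.const_mul M⁻¹)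
    (hg.const_mul N⁻¹) (hh.const_mul (M ^ a * N ^ b)⁻¹)
    (by rw [← ENNReal.mul_iSup, ← hM, ENNReal.inv_mul_cancel hM₀ hf_top])
    (by rw [← ENNReal.mul_iSup, ← hN, ENNReal.inv_mul_cancel hN₀ hg_top]) (fun x y ↦ by
      refine (ENNReal.min_le_geom_mean2_weighted ha hb hab _ _).trans ?_
      rw [ENNReal.mul_rpow_of_nonneg _ _ ha.le, ENNReal.mul_rpow_of_nonneg _ _ hb.le,
        mul_mul_mul_comm, hinv]
      gcongr
      exact hfgh x y)
  have := (ENNReal.geom_mean_le_arith_mean2_weighted ha hb hab _ _).trans key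
  rw [lintegral_const_mul _ hf, lintegral_const_mul _ hg, lintegral_const_mul _ hh,
    ENNReal.mul_rpow_of_nonneg _ _ ha.le, ENNReal.mul_rpow_of_nonneg _ _ hb.le,
    mul_mul_mul_comm, hinv] at this
  rwa [ENNReal.mul_le_mul_iff_right (ENNReal.inv_ne_zero.2 (ENNReal.mul_ne_top hMa' hNb'))
    (ENNReal.inv_ne_top.2 (mul_ne_zero hMa hNb))] at this

theorem ENNReal.iSup_min_natCast (x : ℝ≥0∞) : ⨆ n : ℕ, min x n = x := by
  rw [← inf_iSup_eq, ENNReal.iSup_natCast, inf_top_eq]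

theorem MeasureTheory.lintegral_eq_iSup_lintegral_min_natCast {α : Type*} [MeasurableSpace α]
    (μ : Measure α) {f : α → ℝ≥0∞} (hf : Measurable f) :
    ∫⁻ x, f x ∂μ = ⨆ n : ℕ, ∫⁻ x, min (f x) n ∂μ := by
  rw [← lintegral_iSup (fun n ↦ hf.min measurable_const)
    fun m n hmn x ↦ min_le_min_left _ (by exact_mod_cast hmn)]
  simp only [ENNReal.iSup_min_natCast]

theorem ENNReal.iSup_rpow {ι : Type*} (u : ι → ℝ≥0∞) {a : ℝ} (ha : 0 < a) :
    (⨆ i, u i) ^ a = ⨆ i, u i ^ a :=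
  (ENNReal.orderIsoRpow a ha).map_iSup u

theorem prekopaLeindler_real : PrekopaLeindler ℝ := by
  intro a b ha hb hab f g h hf hg hh hfgh
  rw [lintegral_eq_iSup_lintegral_min_natCast _ hf, lintegral_eq_iSup_lintegral_min_natCast _ hg,
    ENNReal.iSup_rpow _ ha, ENNReal.iSup_rpow _ hb, ENNReal.iSup_mul]
  refine iSup_le fun m ↦ ?_
  rw [ENNReal.mul_iSup]
  have hbdd (f : ℝ → ℝ≥0∞) (k : ℕ) : ⨆ x, min (f x) k ≠ ∞ :=
    ((iSup_le fun _ ↦ min_le_right _ _).trans_lt (ENNReal.natCast_lt_top k)).ne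
  refine iSup_le fun n ↦ Real.prekopaLeindler_of_bounded ha hb hab (hf.min measurable_const)
    (hg.min measurable_const) hh (hbdd f m) (hbdd g n) fun x y ↦ le_trans ?_ (hfgh x y)
  gcongr
  · exact min_le_left _ _
  · exact min_le_left _ _

theorem PrekopaLeindler.prod {E F : Type*} [AddCommGroup E] [Module ℝ E] [MeasureSpace E]
    [AddCommGroup F] [Module ℝ F] [MeasureSpace F] [SFinite (volume : Measure F)]
    (hE : PrekopaLeindler E) (hF : PrekopaLeindler F) : PrekopaLeindler (E × F) := by
  intro a b ha hb hab f g h hf hg hh hfgh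
  rw [Measure.volume_eq_prod, lintegral_prod f hf.aemeasurable, lintegral_prod g hg.aemeasurable,
    lintegral_prod h hh.aemeasurable]
  exact hE ha hb hab hf.lintegral_prod_right' hg.lintegral_prod_right' hh.lintegral_prod_right'
    fun x y ↦ hF ha hb hab (hf.comp measurable_prodMk_left) (hg.comp measurable_prodMk_left)
      (hh.comp measurable_prodMk_left) fun x' y' ↦ hfgh (x, x') (y, y')

theorem PrekopaLeindler.of_measurePreserving {E F : Type*} [AddCommGroup E] [Module ℝ E]
    [MeasureSpace E] [AddCommGroup F] [Module ℝ F] [MeasureSpace F] (hE : PrekopaLeindler E)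
    {e : E → F} (he : MeasurePreserving e)
    (he' : ∀ (a b : ℝ) x y, e (a • x + b • y) = a • e x + b • e y) : PrekopaLeindler F := by
  intro a b ha hb hab f g h hf hg hh hfgh
  rw [← he.lintegral_comp hf, ← he.lintegral_comp hg, ← he.lintegral_comp hh]
  exact hE ha hb hab (hf.comp he.measurable) (hg.comp he.measurable) (hh.comp he.measurable)
    fun x y ↦ by simpa only [Function.comp, he'] using hfgh (e x) (e y)

theorem prekopaLeindler_pi (n : ℕ) : PrekopaLeindler (Fin n → ℝ) := by
  induction n with
  | zero =>
    intro a b ha hb hab f g h hf hg hh hfgh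
    have hdefault : a • (default : Fin 0 → ℝ) + b • default = default := Subsingleton.elim _ _
    have key := hfgh default default
    rw [hdefault] at key
    have hvol : (volume : Measure (Fin 0 → ℝ)) Set.univ = 1 := by
      rw [volume_pi, Measure.pi_of_empty]
      exact measure_univ
    simp only [lintegral_unique, hvol, mul_one]
    convert key
  | succ n ih =>
    refine (prekopaLeindler_real.prod ih).of_measurePreserving
      (volume_preserving_piFinSuccAbove (fun _ ↦ ℝ) 0).symm fun a b x y ↦ ?_
    ext i
    refine Fin.cases ?_ (fun j ↦ ?_) i <;> simp [MeasurableEquiv.piFinSuccAbove]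

theorem prekopaLeindler_euclideanSpace (n : ℕ) : PrekopaLeindler (EuclideanSpace ℝ (Fin n)) :=
  (prekopaLeindler_pi n).of_measurePreserving (PiLp.volume_preserving_toLp (Fin n))
    fun _ _ _ _ ↦ rfl

/-- A convex function on a finite-dimensional space is bounded below by an affine function of
the norm. -/
theorem ConvexOn.exists_sub_mul_norm_le {E : Type*} [NormedAddCommGroup E] [NormedSpace ℝ E]
    [ProperSpace E] {φ : E → ℝ} (hφ : ConvexOn ℝ Set.univ φ) (hc : Continuous φ) :
    ∃ C c : ℝ, ∀ x, C - c * ‖x‖ ≤ φ x := by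
  obtain ⟨M, hM⟩ := (isCompact_closedBall (0 : E) 1).bddAbove_image hc.continuousOn
  refine ⟨φ 0, M - φ 0, fun x ↦ ?_⟩
  have hr : 0 < 1 + ‖x‖ := by positivity
  have hu : φ (-(‖x‖⁻¹ • x)) ≤ M := by
    refine hM ⟨_, ?_, rfl⟩
    rw [mem_closedBall_zero_iff, norm_neg, norm_smul, norm_inv, norm_norm]
    exact inv_mul_le_one
  have hx : ‖x‖ • ‖x‖⁻¹ • x = x := by
    rcases eq_or_ne x 0 with rfl | hx
    · simp
    · exact smul_inv_smul₀ (norm_ne_zero_iff.2 hx) x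
  have key := hφ.2 (Set.mem_univ x) (Set.mem_univ (-(‖x‖⁻¹ • x)))
    (inv_nonneg.2 hr.le) (mul_nonneg (inv_nonneg.2 hr.le) (norm_nonneg x))
    (by field_simp)
  rw [mul_smul, smul_neg, hx, smul_neg, add_neg_cancel, smul_eq_mul, smul_eq_mul, mul_assoc,
    ← mul_add, inv_mul_eq_div, le_div_iff₀ hr] at key
  nlinarith [norm_nonneg x]

theorem integrable_exp_neg_mul_norm_sq {n : ℕ} {b : ℝ} (hb : 0 < b) :
    Integrable fun x : EuclideanSpace ℝ (Fin n) ↦ Real.exp (-b * ‖x‖ ^ 2) := by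
  have := (GaussianFourier.integrable_cexp_neg_mul_sq_norm_add
    (V := EuclideanSpace ℝ (Fin n)) (b := b) (by simpa) 0 0).norm
  refine this.congr (.of_forall fun x ↦ ?_)
  simp only [zero_mul, add_zero, Complex.norm_exp]
  norm_cast

/-- The exponential of minus a strongly convex function is integrable. -/
theorem ConvexOn.integrable_exp_neg {n : ℕ} {μ : ℝ} (hμ : 0 < μ)
    {φ : EuclideanSpace ℝ (Fin n) → ℝ} (hφ : ConvexOn ℝ Set.univ φ) (hc : Continuous φ) :
    Integrable fun x ↦ Real.exp (-(φ x + μ / 2 * ‖x‖ ^ 2)) := by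
  obtain ⟨C, c, h⟩ := hφ.exists_sub_mul_norm_le hc
  refine ((integrable_exp_neg_mul_norm_sq (n := n) (b := μ / 4) (by positivity)).const_mul
    (Real.exp (-C + c ^ 2 / μ))).mono' (by fun_prop) (.of_forall fun x ↦ ?_)
  rw [Real.norm_of_nonneg (Real.exp_pos _).le, ← Real.exp_add, Real.exp_le_exp]
  have h₁ := h x
  have h₂ : c * ‖x‖ ≤ c ^ 2 / μ + μ / 4 * ‖x‖ ^ 2 := by
    have : c ^ 2 / μ + μ / 4 * ‖x‖ ^ 2 - c * ‖x‖ = (c - μ / 2 * ‖x‖) ^ 2 / μ := by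
      field_simp; ring
    have : 0 ≤ (c - μ / 2 * ‖x‖) ^ 2 / μ := by positivity
    linarith
  linarith

/-- **Prékopa's theorem**: marginals of log-concave functions are log-concave. -/
theorem ConvexOn.neg_log_integral_exp_neg {E F : Type*} [AddCommGroup E] [Module ℝ E]
    [AddCommGroup F] [Module ℝ F] [MeasureSpace F] (hF : PrekopaLeindler F)
    [NeZero (volume : Measure F)]
    {W : E × F → ℝ} (hW : ConvexOn ℝ Set.univ W) (hm : ∀ θ, Measurable fun x ↦ W (θ, x))
    (hint : ∀ θ, Integrable fun x ↦ Real.exp (-W (θ, x))) :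
    ConvexOn ℝ Set.univ fun θ ↦ -Real.log (∫ x, Real.exp (-W (θ, x))) := by
  have hpos θ : 0 < ∫ x, Real.exp (-W (θ, x)) := integral_exp_pos (hint θ)
  have hmeas θ : Measurable fun x ↦ ENNReal.ofReal (Real.exp (-W (θ, x))) :=
    (hm θ).neg.exp.ennreal_ofReal
  refine convexOn_iff_forall_pos.2 ⟨convex_univ, fun θ₁ _ θ₂ _ a b ha hb hab ↦ ?_⟩
  have key := hF ha hb hab (hmeas θ₁) (hmeas θ₂) (hmeas (a • θ₁ + b • θ₂)) fun x y ↦ by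
    rw [ENNReal.ofReal_rpow_of_pos (Real.exp_pos _), ENNReal.ofReal_rpow_of_pos (Real.exp_pos _),
      ← ENNReal.ofReal_mul (by positivity), ← Real.exp_mul, ← Real.exp_mul, ← Real.exp_add]
    refine ENNReal.ofReal_le_ofReal (Real.exp_le_exp.2 ?_)
    have := hW.2 (Set.mem_univ (θ₁, x)) (Set.mem_univ (θ₂, y)) ha.le hb.le hab
    simp only [Prod.smul_mk, Prod.mk_add_mk, smul_eq_mul] at this
    linarith
  simp only [← ofReal_integral_eq_lintegral_ofReal (hint _)
    (.of_forall fun _ ↦ (Real.exp_pos _).le)] at key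
  rw [ENNReal.ofReal_rpow_of_pos (hpos _), ENNReal.ofReal_rpow_of_pos (hpos _),
    ← ENNReal.ofReal_mul (Real.rpow_nonneg (hpos _).le _),
    ENNReal.ofReal_le_ofReal_iff (hpos _).le] at key
  have hlog := Real.log_le_log
    (mul_pos (Real.rpow_pos_of_pos (hpos _) _) (Real.rpow_pos_of_pos (hpos _) _)) key
  rw [Real.log_mul (Real.rpow_pos_of_pos (hpos _) _).ne' (Real.rpow_pos_of_pos (hpos _) _).ne',
    Real.log_rpow (hpos _), Real.log_rpow (hpos _)] at hlog
  simp only [smul_eq_mul]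
  linarith

/-- if `U` is continuous and `μ`-strongly convex (i.e. `U - (μ/2)‖·‖²` is
convex) then `k(θ) = ∫ e^{-U(θ,x)} dx` is finite (as witnessed by integrability) and strictly
positive for every `θ`, and `κ = -log k` is `μ`-strongly convex: `κ - (μ/2)‖·‖²` is convex
(Prékopa–Leindler: the θ-marginal of a μ-strongly log-concave density is μ-strongly
log-concave). -/
theorem marginal_strongly_log_concave
    {dθ dx : ℕ} (hdθ : 1 ≤ dθ) (hdx : 1 ≤ dx) (μ : ℝ) (hμ : 0 < μ)
    (U : PairSp dθ dx → ℝ) (hcont : Continuous U)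
    (hconv : ConvexOn ℝ Set.univ (fun v : PairSp dθ dx => U v - μ / 2 * ‖v‖ ^ 2)) :
    (∀ θ : EuclideanSpace ℝ (Fin dθ),
      Integrable (fun x : EuclideanSpace ℝ (Fin dx) => Real.exp (-U (mkPair θ x)))) ∧
    (∀ θ : EuclideanSpace ℝ (Fin dθ),
      0 < ∫ x : EuclideanSpace ℝ (Fin dx), Real.exp (-U (mkPair θ x))) ∧
    ConvexOn ℝ Set.univ (fun θ : EuclideanSpace ℝ (Fin dθ) =>
      -Real.log (∫ x : EuclideanSpace ℝ (Fin dx), Real.exp (-U (mkPair θ x)))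
        - μ / 2 * ‖θ‖ ^ 2) := by
  have hnorm (θ : EuclideanSpace ℝ (Fin dθ)) (x : EuclideanSpace ℝ (Fin dx)) :
      ‖mkPair θ x‖ ^ 2 = ‖θ‖ ^ 2 + ‖x‖ ^ 2 := WithLp.prod_norm_sq_eq_of_L2 _
  have hmk (θ : EuclideanSpace ℝ (Fin dθ)) :
      Continuous fun x : EuclideanSpace ℝ (Fin dx) ↦ mkPair θ x :=
    (WithLp.prod_continuous_toLp 2 _ _).comp (by fun_prop)
  let V : EuclideanSpace ℝ (Fin dθ) × EuclideanSpace ℝ (Fin dx) → ℝ := fun p ↦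
    U (mkPair p.1 p.2) - μ / 2 * ‖mkPair p.1 p.2‖ ^ 2
  have hV : ConvexOn ℝ Set.univ V :=
    hconv.comp_linearMap (WithLp.linearEquiv 2 ℝ _).symm.toLinearMap
  have hVc θ : Continuous fun x ↦ V (θ, x) := by
    have := hmk θ
    simp only [V]
    fun_prop
  have hVθ θ : ConvexOn ℝ Set.univ fun x ↦ V (θ, x) := by
    refine ⟨convex_univ, fun x _ y _ a b ha hb hab ↦ ?_⟩
    have := hV.2 (Set.mem_univ (θ, x)) (Set.mem_univ (θ, y)) ha hb hab
    simpa [← add_smul, hab] using this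
  let W : EuclideanSpace ℝ (Fin dθ) × EuclideanSpace ℝ (Fin dx) → ℝ := fun p ↦
    V p + μ / 2 * ‖p.2‖ ^ 2
  have hsq : ConvexOn ℝ Set.univ fun x : EuclideanSpace ℝ (Fin dx) ↦ μ / 2 * ‖x‖ ^ 2 :=
    ((convexOn_norm convex_univ).pow (fun _ _ ↦ norm_nonneg _) 2).smul (by positivity)
  have hW : ConvexOn ℝ Set.univ W := hV.add (hsq.comp_linearMap (LinearMap.snd ℝ _ _))
  have hWint θ : Integrable fun x ↦ Real.exp (-W (θ, x)) := (hVθ θ).integrable_exp_neg hμ (hVc θ)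
  have hUW θ x : Real.exp (-U (mkPair θ x)) =
      Real.exp (-(μ / 2 * ‖θ‖ ^ 2)) * Real.exp (-W (θ, x)) := by
    rw [← Real.exp_add]
    simp only [W, V, hnorm]
    ring_nf
  have hUint θ : Integrable fun x : EuclideanSpace ℝ (Fin dx) ↦
      Real.exp (-U (mkPair θ x)) := by
    simpa only [hUW] using (hWint θ).const_mul _
  refine ⟨hUint, fun θ ↦ integral_exp_pos (hUint θ), ?_⟩
  refine (hW.neg_log_integral_exp_neg (prekopaLeindler_euclideanSpace dx)
    (fun θ ↦ ((hVc θ).add (by fun_prop)).measurable) hWint).congr fun θ _ ↦ ?_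
  simp only [hUW, integral_const_mul]
  rw [Real.log_mul (Real.exp_pos _).ne' (integral_exp_pos (hWint θ)).ne', Real.log_exp]
  ring
end
end

section
/- Let U : ℝ^{d_θ} × ℝ^{d_x} → ℝ be twice continuously differentiable and let N ≥ 1. On ℝ^{d_θ} × (ℝ^{d_x})^N define ρ(θ, x_1, …, x_N) := exp(−Σ_{i=1}^N U(θ, x_i)) and the drift b(θ, x_1, …, x_N) := (−N^{-1} Σ_{j=1}^N ∇_θ U(θ, x_j), −∇_x U(θ, x_1), …, −∇_x U(θ, x_N)). Then ρ solves the stationary Fokker–Planck equation of the interacting particle Langevin system: for every z = (θ, x_1, …, x_N), −⟨∇ρ(z), b(z)⟩ − ρ(z)·(div b)(z) + N^{-1} Δ_θ ρ(z) + Σ_{i=1}^N Δ_{x_i} ρ(z) = 0, where div b is the sum of the partial derivatives of the components of b, Δ_θ is the Laplacian in the θ-variables and Δ_{x_i} the Laplacian in the x_i-variables. Consequently the measure with density proportional to ρ is an invariant measure of the system. -/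
open MeasureTheory InnerProductSpace
open scoped RealInnerProductSpace

noncomputable section

/-- Divergence of a vector field: the trace of its (Fréchet) derivative. -/
def diverg {E : Type*} [NormedAddCommGroup E] [NormedSpace ℝ E] (f : E → E) (p : E) : ℝ :=
  LinearMap.trace ℝ E (fderiv ℝ f p).toLinearMap

/-- Laplacian of a scalar field: the divergence of its gradient. -/
def lapl {E : Type*} [NormedAddCommGroup E] [InnerProductSpace ℝ E] [CompleteSpace E]
    (f : E → ℝ) (p : E) : ℝ := diverg (gradient f) p

/-- The unnormalised invariant density `ρ(θ, x_1, …, x_N) = exp(-Σᵢ U(θ, xᵢ))`. -/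
def rhoIPS {dθ dx N : ℕ} (U : PairSp dθ dx → ℝ)
    (θ : EuclideanSpace ℝ (Fin dθ)) (xs : Fin N → EuclideanSpace ℝ (Fin dx)) : ℝ :=
  Real.exp (-∑ i, U (mkPair θ (xs i)))

/-- The θ-component of the drift: `-N⁻¹ Σⱼ ∇_θ U(θ, xⱼ)`. -/
def driftTheta {dθ dx N : ℕ} (U : PairSp dθ dx → ℝ)
    (θ : EuclideanSpace ℝ (Fin dθ)) (xs : Fin N → EuclideanSpace ℝ (Fin dx)) :
    EuclideanSpace ℝ (Fin dθ) :=
  -(N : ℝ)⁻¹ • ∑ j, gradient (fun θ' => U (mkPair θ' (xs j))) θ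

/-- The x-component of the drift: `-∇_x U(θ, x)`. -/
def driftX {dθ dx : ℕ} (U : PairSp dθ dx → ℝ)
    (θ : EuclideanSpace ℝ (Fin dθ)) (x : EuclideanSpace ℝ (Fin dx)) :
    EuclideanSpace ℝ (Fin dx) :=
  -gradient (fun x' => U (mkPair θ x')) x

theorem fderiv_exp_neg {E : Type*} [NormedAddCommGroup E] [NormedSpace ℝ E] {V : E → ℝ}
    (hV : Differentiable ℝ V) (q : E) :
    fderiv ℝ (fun x => Real.exp (-V x)) q = -(Real.exp (-V q) • fderiv ℝ V q) := by
  rw [fderiv_exp (hV q).fun_neg, fderiv_fun_neg, smul_neg]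

/-- The gradient of `exp (-V)` is `-exp (-V) • ∇V`. -/
theorem gradient_exp_neg {E : Type*} [NormedAddCommGroup E] [InnerProductSpace ℝ E]
    [CompleteSpace E] {V : E → ℝ} (hV : Differentiable ℝ V) :
    gradient (fun q => Real.exp (-V q)) = fun q => -(Real.exp (-V q) • gradient V q) := by
  funext q
  rw [gradient, fderiv_exp_neg hV, gradient]
  simp

/-- The gradient of a twice continuously differentiable function is differentiable. -/
theorem ContDiff.differentiable_gradient {E : Type*} [NormedAddCommGroup E]
    [InnerProductSpace ℝ E] [CompleteSpace E] {V : E → ℝ} (hV : ContDiff ℝ 2 V) :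
    Differentiable ℝ (gradient V) :=
  (InnerProductSpace.toDual ℝ E).symm.toContinuousLinearEquiv.differentiable.comp
    ((hV.fderiv_right (m := 1) (by norm_num)).differentiable (by norm_num))

theorem diverg_const_smul {E : Type*} [NormedAddCommGroup E] [NormedSpace ℝ E] {f : E → E}
    {p : E} (hf : DifferentiableAt ℝ f p) (c : ℝ) :
    diverg (fun q => c • f q) p = c * diverg f p := by
  simp [diverg, fderiv_fun_const_smul hf]

/-- The Leibniz rule for the divergence of a scalar multiple of a vector field. -/
theorem diverg_smul {E : Type*} [NormedAddCommGroup E] [InnerProductSpace ℝ E]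
    [FiniteDimensional ℝ E] {g : E → ℝ} {f : E → E} {p : E} (hg : DifferentiableAt ℝ g p)
    (hf : DifferentiableAt ℝ f p) :
    diverg (fun q => g q • f q) p = g p * diverg f p + fderiv ℝ g p (f p) := by
  simp [diverg, fderiv_fun_smul hg hf, LinearMap.trace_smulRight]

/-- A drift `-c • ∇V` with diffusion coefficient `c` leaves `exp (-V)` stationary. -/
theorem fokker_planck_exp_neg {E : Type*} [NormedAddCommGroup E] [InnerProductSpace ℝ E]
    [FiniteDimensional ℝ E] {V : E → ℝ} (hV : ContDiff ℝ 2 V) (c : ℝ) (p : E) :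
    -⟪gradient (fun q => Real.exp (-V q)) p, (-c) • gradient V p⟫_ℝ
      - Real.exp (-V p) * diverg (fun q => (-c) • gradient V q) p
      + c * lapl (fun q => Real.exp (-V q)) p = 0 := by
  have hV1 : Differentiable ℝ V := hV.differentiable (by norm_num)
  have hg := hV.differentiable_gradient
  have hexp : DifferentiableAt ℝ (fun q => -Real.exp (-V q)) p := (hV1 p).neg.exp.neg
  have hlapl : lapl (fun q => Real.exp (-V q)) p
      = -Real.exp (-V p) * diverg (gradient V) p
        + Real.exp (-V p) * ⟪gradient V p, gradient V p⟫_ℝ := by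
    have hd : fderiv ℝ (fun q => -Real.exp (-V q)) p = Real.exp (-V p) • fderiv ℝ V p := by
      rw [fderiv_fun_neg, fderiv_exp_neg hV1, neg_neg]
    rw [lapl, gradient_exp_neg hV1]
    simp only [← neg_smul]
    rw [diverg_smul hexp (hg p), hd, FunLike.coe_smul, Pi.smul_apply, smul_eq_mul]
    simp only [gradient, InnerProductSpace.toDual_symm_apply]
  rw [hlapl, diverg_const_smul (hg p), gradient_exp_neg hV1]
  simp only [inner_neg_left, inner_smul_left, inner_smul_right, RCLike.conj_to_real]
  ring

theorem contDiff_mkPair {dθ dx : ℕ} :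
    ContDiff ℝ 2 (fun p : EuclideanSpace ℝ (Fin dθ) × EuclideanSpace ℝ (Fin dx) =>
      mkPair p.1 p.2) :=
  (WithLp.prodContinuousLinearEquiv 2 ℝ (EuclideanSpace ℝ (Fin dθ))
    (EuclideanSpace ℝ (Fin dx))).symm.contDiff

/-- stationary Fokker–Planck equation: for twice continuously differentiable
`U`, the density `ρ(θ, x_1, …, x_N) = exp(-Σᵢ U(θ, xᵢ))` satisfies, at every point,
`-⟨∇ρ, b⟩ - ρ · div b + N⁻¹ Δ_θ ρ + Σᵢ Δ_{xᵢ} ρ = 0`, where `b` is the drift of the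
interacting particle Langevin system; hence the measure with density proportional to `ρ`
is invariant for the system. -/
theorem stationary_fokker_planck
    {dθ dx N : ℕ} (hdθ : 1 ≤ dθ) (hdx : 1 ≤ dx) (hN : 1 ≤ N)
    (U : PairSp dθ dx → ℝ) (hU : ContDiff ℝ 2 U) :
    ∀ (θ : EuclideanSpace ℝ (Fin dθ)) (xs : Fin N → EuclideanSpace ℝ (Fin dx)),
      -(⟪gradient (fun θ' => rhoIPS U θ' xs) θ, driftTheta U θ xs⟫_ℝ
          + ∑ i, ⟪gradient (fun x => rhoIPS U θ (Function.update xs i x)) (xs i),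
              driftX U θ (xs i)⟫_ℝ)
        - rhoIPS U θ xs *
            (diverg (fun θ' => driftTheta U θ' xs) θ + ∑ i, diverg (driftX U θ) (xs i))
        + (N : ℝ)⁻¹ * lapl (fun θ' => rhoIPS U θ' xs) θ
        + ∑ i, lapl (fun x => rhoIPS U θ (Function.update xs i x)) (xs i) = 0 := by
  intro θ xs
  have hUp : ContDiff ℝ 2 (fun p : EuclideanSpace ℝ (Fin dθ) × EuclideanSpace ℝ (Fin dx) =>
      U (mkPair p.1 p.2)) := hU.comp contDiff_mkPair
  have hUθ : ∀ x, ContDiff ℝ 2 (fun θ' => U (mkPair θ' x)) := fun x =>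
    hUp.comp (contDiff_id.prodMk contDiff_const)
  have hUx : ContDiff ℝ 2 (fun x => U (mkPair θ x)) :=
    hUp.comp (contDiff_const.prodMk contDiff_id)
  have hθ : -⟪gradient (fun θ' => rhoIPS U θ' xs) θ, driftTheta U θ xs⟫_ℝ
      - rhoIPS U θ xs * diverg (fun θ' => driftTheta U θ' xs) θ
      + (N : ℝ)⁻¹ * lapl (fun θ' => rhoIPS U θ' xs) θ = 0 := by
    have hdrift : (fun θ' => driftTheta U θ' xs)
        = fun θ' => (-(N : ℝ)⁻¹) • gradient (fun θ'' => ∑ j, U (mkPair θ'' (xs j))) θ' := by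
      funext θ'
      simp only [driftTheta, gradient]
      rw [fderiv_fun_sum fun j _ => (hUθ (xs j)).differentiable (by norm_num) θ', map_sum]
    rw [congrFun hdrift θ, hdrift]
    exact fokker_planck_exp_neg (ContDiff.sum fun j _ => hUθ (xs j)) _ θ
  have hx : ∀ i, -⟪gradient (fun x => rhoIPS U θ (Function.update xs i x)) (xs i),
        driftX U θ (xs i)⟫_ℝ - rhoIPS U θ xs * diverg (driftX U θ) (xs i)
      + lapl (fun x => rhoIPS U θ (Function.update xs i x)) (xs i) = 0 := by
    intro i
    set C : ℝ := ∑ j ∈ Finset.univ \ {i}, U (mkPair θ (xs j)) with hC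
    have hsum : ∀ x, rhoIPS U θ (Function.update xs i x)
        = Real.exp (-(U (mkPair θ x) + C)) := by
      intro x
      rw [rhoIPS, Finset.sum_eq_add_sum_sdiff_singleton_of_mem (Finset.mem_univ i),
        Function.update_self, hC]
      congr 3
      refine Finset.sum_congr rfl fun j hj => ?_
      rw [Function.update_of_ne (by simpa using hj)]
    have hdrift : driftX U θ
        = fun x => (-1 : ℝ) • gradient (fun x' => U (mkPair θ x') + C) x := by
      funext x
      simp only [driftX, gradient, fderiv_add_const, neg_smul, one_smul]
    have hself : rhoIPS U θ xs = Real.exp (-(U (mkPair θ (xs i)) + C)) := by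
      rw [← hsum, Function.update_eq_self]
    have h := fokker_planck_exp_neg (hUx.add contDiff_const : ContDiff ℝ 2 fun x =>
      U (mkPair θ x) + C) 1 (xs i)
    rw [one_mul] at h
    rw [hself, hdrift]
    simpa only [hsum] using h
  have hxs := Finset.sum_eq_zero fun i (_ : i ∈ Finset.univ) => hx i
  rw [Finset.sum_add_distrib, Finset.sum_sub_distrib, Finset.sum_neg_distrib,
    ← Finset.mul_sum] at hxs
  linear_combination hθ + hxs
end
end
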